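/- arXiv:2401.06020 — 3 statements merged into one kernel-verified Lean document; each statement's English description precedes it below -/
import Mathlib

section
/- Fix a payoff stream X_{0:T} with X_t ≤ X̄_t pointwise for constants X̄_t ∈ ℝ, and let F(X) be the set of adapted premium schedules feasible for the risk-neutral risk frontier at X_{0:T}, i.e., Φ_{0:T+1} with Φ_{T+1} ≡ 0 and Φ_t(h_t) ≥ E[Φ_{t+1} − X_t | h_t] for all h_t ∈ ℍ_t and t ∈ [T]. Then: (a) every Φ ∈ F(X) satisfies Φ_t(h_t) ≥ −Σ_{k=t}^{T} X̄_k for all h_t ∈ ℍ_t and t ∈ [T]; (b) if moreover φ₀ ≤ τ, then E[Φ_{t+1}] ≤ τ + Σ_{k=0}^{t} X̄_k for all t ∈ [T−1]. Consequently, for every τ ∈ ℝ the sublevel set {Φ ∈ F(X) : φ₀ ≤ τ} is bounded. -/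
open scoped Classical

/-- The (finite) trajectory space `Ω = S × Ξ^{T+1}`. -/
abbrev Traj (S Ξ : Type*) (T : ℕ) : Type _ := S × (Fin (T + 1) → Ξ)

/-- Two trajectories share the same history `h_t` at the beginning of period `t`. -/
def agree {S Ξ : Type*} (T t : ℕ) (ω ω' : Traj S Ξ T) : Prop :=
  (t ≠ 0 → ω.1 = ω'.1) ∧ ∀ i : Fin (T + 1), (i : ℕ) < t → ω.2 i = ω'.2 i

/-- `f` is measurable with respect to `𝓕_t = σ(h_t)`. -/
def MeasUpTo {S Ξ : Type*} (T t : ℕ) (f : Traj S Ξ T → ℝ) : Prop :=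
  ∀ ω ω' : Traj S Ξ T, agree T t ω ω' → f ω = f ω'

def finOf (T k : ℕ) : Fin (T + 1) := ⟨k % (T + 1), Nat.mod_lt _ (Nat.succ_pos T)⟩

/-- The conditional random variable `[f | h_t]`, viewed as a function of `ξ_t ∈ Ξ`. -/
def condRV {S Ξ : Type*} (T t : ℕ) (f : Traj S Ξ T → ℝ) (ω : Traj S Ξ T) : Ξ → ℝ :=
  fun ξ => f (ω.1, Function.update ω.2 (finOf T t) ξ)

/-- The process `(Z_k)_{k ≤ n}` is adapted: `Z_k` is `𝓕_k`-measurable for `k ≤ n`. -/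
def AdaptedTill {S Ξ : Type*} (T n : ℕ) (Z : ℕ → Traj S Ξ T → ℝ) : Prop :=
  ∀ k, k ≤ n → MeasUpTo T k (Z k)

/-- A payoff stream: `X_k` is `𝓕_{k+1}`-measurable for `k ∈ [T]`. -/
def IsPayoff {S Ξ : Type*} (T : ℕ) (X : ℕ → Traj S Ξ T → ℝ) : Prop :=
  ∀ k, k ≤ T → MeasUpTo T (k + 1) (X k)

/-- `p` is a probability mass function giving positive probability to every point. -/
def IsProb {S Ξ : Type*} [Fintype S] [Fintype Ξ] (T : ℕ) (p : Traj S Ξ T → ℝ) : Prop :=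
  (∀ ω, 0 < p ω) ∧ ∑ ω, p ω = 1

/-- Conditional expectation `E[f | h_t]` evaluated along the trajectory `ω`. -/
noncomputable def condExp {S Ξ : Type*} [Fintype S] [Fintype Ξ] (T : ℕ)
    (p : Traj S Ξ T → ℝ) (t : ℕ) (f : Traj S Ξ T → ℝ) (ω : Traj S Ξ T) : ℝ :=
  (∑ ω' ∈ Finset.univ.filter (fun ω' => agree T t ω ω'), p ω' * f ω') /
    ∑ ω' ∈ Finset.univ.filter (fun ω' => agree T t ω ω'), p ω'

/-- Expectation `E[f]`. -/
noncomputable def expec {S Ξ : Type*} [Fintype S] [Fintype Ξ] (T : ℕ)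
    (p : Traj S Ξ T → ℝ) (f : Traj S Ξ T → ℝ) : ℝ :=
  ∑ ω, p ω * f ω

namespace Stmt16

/-- The set `F(X)` of adapted premium schedules feasible for the risk-neutral
risk frontier at the payoff stream `X`: `Φ_{T+1} ≡ 0` and
`Φ_t(h_t) ≥ E[Φ_{t+1} − X_t | h_t]` for all `h_t` and `t ∈ [T]`. -/
def Feas {S Ξ : Type*} [Fintype S] [Fintype Ξ] (T : ℕ) (p : Traj S Ξ T → ℝ)
    (X : ℕ → Traj S Ξ T → ℝ) (Φ : ℕ → Traj S Ξ T → ℝ) : Prop :=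
  AdaptedTill T (T + 1) Φ ∧ (∀ ω, Φ (T + 1) ω = 0) ∧
    ∀ t, t ≤ T → ∀ ω, condExp T p t (fun ω' => Φ (t + 1) ω' - X t ω') ω ≤ Φ t ω

theorem sum_agree_pos {S Ξ : Type*} [Fintype S] [Fintype Ξ] {T : ℕ} {p : Traj S Ξ T → ℝ}
    (hp : ∀ ω, 0 < p ω) (t : ℕ) (ω : Traj S Ξ T) :
    0 < ∑ ω' ∈ Finset.univ.filter (fun ω' => agree T t ω ω'), p ω' :=
  Finset.sum_pos (fun _ _ => hp _)
    ⟨ω, Finset.mem_filter.mpr ⟨Finset.mem_univ ω, fun _ => rfl, fun _ _ => rfl⟩⟩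

theorem le_condExp {S Ξ : Type*} [Fintype S] [Fintype Ξ] {T : ℕ} {p : Traj S Ξ T → ℝ}
    (hp : ∀ ω, 0 < p ω) (t : ℕ) {f : Traj S Ξ T → ℝ} {c : ℝ} (hf : ∀ ω, c ≤ f ω)
    (ω : Traj S Ξ T) : c ≤ condExp T p t f ω := by
  rw [condExp, le_div_iff₀ (sum_agree_pos hp t ω), Finset.mul_sum]
  refine Finset.sum_le_sum fun ω' _ => ?_
  rw [mul_comm]
  exact mul_le_mul_of_nonneg_left (hf ω') (hp ω').le

theorem agree_symm {S Ξ : Type*} {T t : ℕ} {ω ω' : Traj S Ξ T} (h : agree T t ω ω') :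
    agree T t ω' ω :=
  ⟨fun ht => (h.1 ht).symm, fun i hi => (h.2 i hi).symm⟩

theorem agree_trans {S Ξ : Type*} {T t : ℕ} {ω₁ ω₂ ω₃ : Traj S Ξ T} (h : agree T t ω₁ ω₂)
    (h' : agree T t ω₂ ω₃) : agree T t ω₁ ω₃ :=
  ⟨fun ht => (h.1 ht).trans (h'.1 ht), fun i hi => (h.2 i hi).trans (h'.2 i hi)⟩

theorem filter_agree_congr {S Ξ : Type*} [Fintype S] [Fintype Ξ] {T t : ℕ} {ω ω' : Traj S Ξ T}
    (h : agree T t ω ω') :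
    Finset.univ.filter (fun η => agree T t ω η) = Finset.univ.filter (fun η => agree T t ω' η) :=
  Finset.filter_congr fun _ _ => ⟨agree_trans (agree_symm h), agree_trans h⟩

/-- The law of total expectation. -/
theorem expec_condExp {S Ξ : Type*} [Fintype S] [Fintype Ξ] {T : ℕ} {p : Traj S Ξ T → ℝ}
    (hp : ∀ ω, 0 < p ω) (t : ℕ) (f : Traj S Ξ T → ℝ) :
    expec T p (condExp T p t f) = expec T p f := by
  let P : Traj S Ξ T → ℝ := fun ω => ∑ η ∈ Finset.univ.filter (fun η => agree T t ω η), p η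
  have key : ∀ ω, p ω * condExp T p t f ω =
      ∑ ω', if agree T t ω ω' then p ω' * f ω' * (p ω / P ω') else 0 := by
    intro ω
    rw [condExp, ← mul_div_assoc, Finset.mul_sum, Finset.sum_div, Finset.sum_filter]
    refine Finset.sum_congr rfl fun ω' _ => ?_
    split_ifs with h
    · simp only [P, filter_agree_congr h]
      ring
    · rfl
  unfold expec
  simp_rw [key]
  rw [Finset.sum_comm]
  refine Finset.sum_congr rfl fun ω' _ => ?_
  have hfilter : Finset.univ.filter (fun ω => agree T t ω ω') =
      Finset.univ.filter (fun ω => agree T t ω' ω) :=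
    Finset.filter_congr fun _ _ => ⟨agree_symm, agree_symm⟩
  rw [← Finset.sum_filter, ← Finset.mul_sum, ← Finset.sum_div, hfilter,
    div_self (sum_agree_pos hp t ω').ne', mul_one]

theorem expec_mono {S Ξ : Type*} [Fintype S] [Fintype Ξ] {T : ℕ} {p : Traj S Ξ T → ℝ}
    (hp : ∀ ω, 0 < p ω) {f g : Traj S Ξ T → ℝ} (h : ∀ ω, f ω ≤ g ω) :
    expec T p f ≤ expec T p g :=
  Finset.sum_le_sum fun ω _ => mul_le_mul_of_nonneg_left (h ω) (hp ω).le

theorem expec_add_const {S Ξ : Type*} [Fintype S] [Fintype Ξ] {T : ℕ} {p : Traj S Ξ T → ℝ}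
    (hp : IsProb T p) (f : Traj S Ξ T → ℝ) (c : ℝ) :
    expec T p (fun ω => f ω + c) = expec T p f + c := by
  simp only [expec, mul_add, Finset.sum_add_distrib, ← Finset.sum_mul, hp.2, one_mul]

theorem expec_const {S Ξ : Type*} [Fintype S] [Fintype Ξ] {T : ℕ} {p : Traj S Ξ T → ℝ}
    (hp : IsProb T p) (c : ℝ) : expec T p (fun _ => c) = c := by
  rw [expec, ← Finset.sum_mul, hp.2, one_mul]

/-- A feasible premium schedule is bounded below by minus the remaining payoff bounds. -/
theorem Feas.neg_sum_le {S Ξ : Type*} [Fintype S] [Fintype Ξ] {T : ℕ} {p : Traj S Ξ T → ℝ}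
    (hp : IsProb T p) {X Φ : ℕ → Traj S Ξ T → ℝ} {Xbar : ℕ → ℝ}
    (hXbar : ∀ t, t ≤ T → ∀ ω, X t ω ≤ Xbar t) (hΦ : Feas T p X Φ) {t : ℕ} (ht : t ≤ T + 1) :
    ∀ ω, -(∑ k ∈ Finset.Icc t T, Xbar k) ≤ Φ t ω := by
  induction ht using Nat.decreasingInduction with
  | self => intro ω; simp [hΦ.2.1 ω]
  | of_succ t ht ih =>
    have htT : t ≤ T := Nat.lt_succ_iff.mp ht
    refine fun ω => (le_condExp hp.1 t (fun ω' => ?_) ω).trans (hΦ.2.2 t htT ω)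
    rw [← Finset.add_sum_Ioc_eq_sum_Icc htT, ← Finset.Icc_add_one_left_eq_Ioc]
    linarith [ih ω', hXbar t htT ω']

/-- The expected premium is bounded above by the initial premium plus the past payoff bounds. -/
theorem Feas.expec_le {S Ξ : Type*} [Fintype S] [Fintype Ξ] {T : ℕ} {p : Traj S Ξ T → ℝ}
    (hp : IsProb T p) {X Φ : ℕ → Traj S Ξ T → ℝ} {Xbar : ℕ → ℝ}
    (hXbar : ∀ t, t ≤ T → ∀ ω, X t ω ≤ Xbar t) (hΦ : Feas T p X Φ) {τ : ℝ}
    (hτ : ∀ ω, Φ 0 ω ≤ τ) {t : ℕ} (ht : t ≤ T + 1) :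
    expec T p (Φ t) ≤ τ + ∑ k ∈ Finset.range t, Xbar k := by
  induction t with
  | zero => simpa [expec_const hp] using expec_mono hp.1 hτ
  | succ t ih =>
    have htT : t ≤ T := Nat.le_of_succ_le_succ ht
    have h₁ : expec T p (fun ω => Φ (t + 1) ω - X t ω) ≤ expec T p (Φ t) :=
      (expec_condExp hp.1 t _).symm.trans_le (expec_mono hp.1 (hΦ.2.2 t htT))
    have h₂ : expec T p (fun ω => Φ (t + 1) ω + -Xbar t) ≤
        expec T p (fun ω => Φ (t + 1) ω - X t ω) :=
      expec_mono hp.1 fun ω => by linarith [hXbar t htT ω]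
    rw [expec_add_const hp] at h₂
    rw [Finset.sum_range_succ]
    linarith [ih (htT.trans (Nat.le_succ T))]

/-- A function with a pointwise lower bound and an upper bound on its expectation is bounded. -/
theorem abs_le_of_neg_le_of_expec_le {S Ξ : Type*} [Fintype S] [Fintype Ξ] {T : ℕ}
    {p : Traj S Ξ T → ℝ} (hp : IsProb T p) {f : Traj S Ξ T → ℝ} {L U : ℝ}
    (hL : ∀ ω, -L ≤ f ω) (hU : expec T p f ≤ U) (ω : Traj S Ξ T) :
    |f ω| ≤ |L| + |U + L| / p ω := by
  have hsingle : p ω * (f ω + L) ≤ expec T p (fun ω => f ω + L) :=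
    Finset.single_le_sum (f := fun ω => p ω * (f ω + L))
      (fun ω' _ => mul_nonneg (hp.1 ω').le (by linarith [hL ω'])) (Finset.mem_univ ω)
  rw [expec_add_const hp] at hsingle
  have hdiv : f ω + L ≤ |U + L| / p ω := by
    rw [le_div_iff₀ (hp.1 ω)]
    linarith [le_abs_self (U + L)]
  have hnonneg : 0 ≤ |U + L| / p ω := div_nonneg (abs_nonneg _) (hp.1 ω).le
  rw [abs_le]
  constructor <;> linarith [hL ω, le_abs_self L, neg_abs_le L]

/-- lower and upper bounds for feasible premium schedules of the
risk-neutral risk frontier, and boundedness of the sublevel sets. -/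
theorem stmt16 {S Ξ : Type*} [Fintype S] [Fintype Ξ] (T : ℕ)
    (p : Traj S Ξ T → ℝ) (hp : IsProb T p)
    (X : ℕ → Traj S Ξ T → ℝ) (hX : IsPayoff T X)
    (Xbar : ℕ → ℝ) (hXbar : ∀ t, t ≤ T → ∀ ω, X t ω ≤ Xbar t) :
    -- (a) uniform lower bound
    (∀ Φ, Feas T p X Φ → ∀ t, t ≤ T → ∀ ω,
      -(∑ k ∈ Finset.Icc t T, Xbar k) ≤ Φ t ω) ∧
    -- (b) bound on expectations under the sublevel constraint φ₀ ≤ τ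
    (∀ Φ, Feas T p X Φ → ∀ τ : ℝ, (∀ ω, Φ 0 ω ≤ τ) →
      ∀ t, t + 1 ≤ T → expec T p (Φ (t + 1)) ≤ τ + ∑ k ∈ Finset.range (t + 1), Xbar k) ∧
    -- consequently, every sublevel set is bounded
    ∀ τ : ℝ, ∃ C : ℝ, ∀ Φ, Feas T p X Φ → (∀ ω, Φ 0 ω ≤ τ) →
      ∀ t, t ≤ T + 1 → ∀ ω, |Φ t ω| ≤ C := by
  refine ⟨fun Φ hΦ t ht => hΦ.neg_sum_le hp hXbar (ht.trans (Nat.le_succ T)),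
    fun Φ hΦ τ hτ t ht => hΦ.expec_le hp hXbar hτ (ht.trans (Nat.le_succ T)), fun τ => ?_⟩
  let L : ℕ → ℝ := fun t => ∑ k ∈ Finset.Icc t T, Xbar k
  let B : ℕ → Traj S Ξ T → ℝ := fun t ω =>
    |L t| + |τ + ∑ k ∈ Finset.range t, Xbar k + L t| / p ω
  have hB : ∀ t ω, 0 ≤ B t ω := fun t ω =>
    add_nonneg (abs_nonneg _) (div_nonneg (abs_nonneg _) (hp.1 ω).le)
  refine ⟨∑ t ∈ Finset.range (T + 2), ∑ ω, B t ω, fun Φ hΦ hτ t ht ω => ?_⟩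
  calc |Φ t ω| ≤ B t ω := abs_le_of_neg_le_of_expec_le hp (hΦ.neg_sum_le hp hXbar ht)
        (hΦ.expec_le hp hXbar hτ ht) ω
    _ ≤ ∑ ω, B t ω := Finset.single_le_sum (fun ω _ => hB t ω) (Finset.mem_univ ω)
    _ ≤ ∑ t ∈ Finset.range (T + 2), ∑ ω, B t ω :=
      Finset.single_le_sum (f := fun t => ∑ ω, B t ω)
        (fun t _ => Finset.sum_nonneg fun ω _ => hB t ω)
        (Finset.mem_range.mpr (Nat.lt_succ_of_le ht))

end Stmt16
end

section
/- Fix γ > 0 and a payoff stream X_{0:T} with 0 ≤ X_t ≤ X̄_t pointwise for constants X̄_t ∈ ℝ, and let F(X) be the set of adapted premium schedules feasible for the entropic risk frontier at X_{0:T}, i.e., Φ_{0:T+1} with Φ_{T+1} ≡ 1 and Φ_t(h_t) ≥ E[e^{−γ X_t} Φ_{t+1} | h_t] for all h_t ∈ ℍ_t and t ∈ [T]. Then: (a) every Φ ∈ F(X) satisfies Φ_t(h_t) ≥ e^{−γ Σ_{k=t}^{T} X̄_k} > 0 for all h_t ∈ ℍ_t and t ∈ [T]; (b) if moreover φ₀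 ≤ τ, then E[Φ_{t+1}] ≤ τ · e^{γ Σ_{k=0}^{t} X̄_k} for all t ∈ [T−1]. Consequently, for every τ ∈ ℝ the sublevel set {Φ ∈ F(X) : φ₀ ≤ τ} is bounded. -/
open scoped Classical

namespace Stmt17

/-- The set `F(X)` of adapted premium schedules feasible for the entropic risk
frontier at the payoff stream `X`: `Φ_{T+1} ≡ 1` and
`Φ_t(h_t) ≥ E[e^{−γ X_t} Φ_{t+1} | h_t]` for all `h_t` and `t ∈ [T]`. -/
def Feas {S Ξ : Type*} [Fintype S] [Fintype Ξ] (T : ℕ) (p : Traj S Ξ T → ℝ)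
    (γ : ℝ) (X : ℕ → Traj S Ξ T → ℝ) (Φ : ℕ → Traj S Ξ T → ℝ) : Prop :=
  AdaptedTill T (T + 1) Φ ∧ (∀ ω, Φ (T + 1) ω = 1) ∧
    ∀ t, t ≤ T → ∀ ω,
      condExp T p t (fun ω' => Real.exp (-γ * X t ω') * Φ (t + 1) ω') ω ≤ Φ t ω

theorem agree_refl {S Ξ : Type*} (T t : ℕ) (ω : Traj S Ξ T) : agree T t ω ω :=
  ⟨fun _ => rfl, fun _ _ => rfl⟩

theorem agree_symm {S Ξ : Type*} {T t : ℕ} {ω ω' : Traj S Ξ T} (h : agree T t ω ω') :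
    agree T t ω' ω :=
  ⟨fun ht => (h.1 ht).symm, fun i hi => (h.2 i hi).symm⟩

theorem agree_trans {S Ξ : Type*} {T t : ℕ} {ω ω' ω'' : Traj S Ξ T}
    (h : agree T t ω ω') (h' : agree T t ω' ω'') : agree T t ω ω'' :=
  ⟨fun ht => (h.1 ht).trans (h'.1 ht), fun i hi => (h.2 i hi).trans (h'.2 i hi)⟩

section ConditionalExpectation

variable {S Ξ : Type*} [Fintype S] [Fintype Ξ] {T : ℕ} {p : Traj S Ξ T → ℝ}

theorem sum_agree_pos (hp : ∀ ω, 0 < p ω) (t : ℕ) (ω : Traj S Ξ T) :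
    0 < ∑ ω' ∈ Finset.univ.filter (fun ω' => agree T t ω ω'), p ω' :=
  Finset.sum_pos (fun ω' _ => hp ω') ⟨ω, by simp [agree_refl]⟩

/-- A uniform lower bound passes to conditional expectations. -/
theorem le_condExp (hp : ∀ ω, 0 < p ω) (t : ℕ) {f : Traj S Ξ T → ℝ} {c : ℝ}
    (hf : ∀ ω, c ≤ f ω) (ω : Traj S Ξ T) : c ≤ condExp T p t f ω := by
  unfold condExp
  rw [le_div_iff₀ (sum_agree_pos hp t ω), Finset.mul_sum]
  refine Finset.sum_le_sum fun ω' _ => ?_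
  rw [mul_comm]
  exact mul_le_mul_of_nonneg_left (hf ω') (hp ω').le

/-- The tower property `E[E[f | h_t]] = E[f]`. -/
theorem expec_condExp (hp : ∀ ω, 0 < p ω) (t : ℕ) (f : Traj S Ξ T → ℝ) :
    expec T p (condExp T p t f) = expec T p f := by
  set P : Traj S Ξ T → ℝ :=
    fun ω => ∑ ω' ∈ Finset.univ.filter (fun ω' => agree T t ω ω'), p ω' with hP
  have hPeq : ∀ ω ω', agree T t ω ω' → P ω = P ω' := by
    intro ω ω' h
    simp only [hP]
    congr 1
    ext ω''
    simp only [Finset.mem_filter, Finset.mem_univ, true_and]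
    exact ⟨agree_trans (agree_symm h), agree_trans h⟩
  calc expec T p (condExp T p t f)
      = ∑ ω, ∑ ω', if agree T t ω ω' then p ω * (p ω' * f ω') / P ω else 0 := by
        unfold expec condExp
        refine Finset.sum_congr rfl fun ω _ => ?_
        rw [← Finset.sum_filter, ← mul_div_assoc, Finset.mul_sum, Finset.sum_div]
    _ = ∑ ω', ∑ ω, if agree T t ω' ω then p ω * (p ω' * f ω' / P ω') else 0 := by
        rw [Finset.sum_comm]
        refine Finset.sum_congr rfl fun ω' _ => Finset.sum_congr rfl fun ω _ => ?_
        by_cases h : agree T t ω ω'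
        · rw [if_pos h, if_pos (agree_symm h), hPeq ω ω' h, mul_div_assoc]
        · rw [if_neg h, if_neg fun h' => h (agree_symm h')]
    _ = expec T p f := by
        unfold expec
        refine Finset.sum_congr rfl fun ω' _ => ?_
        rw [← Finset.sum_filter, ← Finset.sum_mul]
        exact mul_div_cancel₀ _ (sum_agree_pos hp t ω').ne'

theorem expec_mono (hp : ∀ ω, 0 < p ω) {f g : Traj S Ξ T → ℝ} (h : ∀ ω, f ω ≤ g ω) :
    expec T p f ≤ expec T p g :=
  Finset.sum_le_sum fun ω _ => mul_le_mul_of_nonneg_left (h ω) (hp ω).le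

theorem expec_const_mul (c : ℝ) (f : Traj S Ξ T → ℝ) :
    expec T p (fun ω => c * f ω) = c * expec T p f := by
  unfold expec
  rw [Finset.mul_sum]
  exact Finset.sum_congr rfl fun ω _ => by ring

end ConditionalExpectation

section Feasible

variable {S Ξ : Type*} [Fintype S] [Fintype Ξ] {T : ℕ} {p : Traj S Ξ T → ℝ} {γ : ℝ}
  {X Φ : ℕ → Traj S Ξ T → ℝ} {Xbar : ℕ → ℝ}

theorem Feas.exp_le (hp : ∀ ω, 0 < p ω) (hγ : 0 < γ)
    (hXbar : ∀ t, t ≤ T → ∀ ω, X t ω ≤ Xbar t) (hΦ : Feas T p γ X Φ)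
    {t : ℕ} (ht : t ≤ T + 1) (ω : Traj S Ξ T) :
    Real.exp (-γ * ∑ k ∈ Finset.Icc t T, Xbar k) ≤ Φ t ω := by
  induction ht using Nat.decreasingInduction generalizing ω with
  | self => simp [hΦ.2.1]
  | of_succ t ht ih =>
    have htT : t ≤ T := Nat.lt_succ_iff.mp ht
    refine le_trans (le_condExp hp t (fun ω' => ?_) ω) (hΦ.2.2 t htT ω)
    rw [← Finset.add_sum_Ioc_eq_sum_Icc htT, ← Finset.Icc_add_one_left_eq_Ioc, mul_add,
      Real.exp_add]
    refine mul_le_mul (Real.exp_le_exp.mpr ?_) (ih ω') (Real.exp_pos _).le (Real.exp_pos _).le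
    nlinarith [hXbar t htT ω']

theorem Feas.pos (hp : ∀ ω, 0 < p ω) (hγ : 0 < γ)
    (hXbar : ∀ t, t ≤ T → ∀ ω, X t ω ≤ Xbar t) (hΦ : Feas T p γ X Φ)
    {t : ℕ} (ht : t ≤ T + 1) (ω : Traj S Ξ T) : 0 < Φ t ω :=
  (Real.exp_pos _).trans_le (hΦ.exp_le hp hγ hXbar ht ω)

theorem Feas.expec_succ_le (hp : ∀ ω, 0 < p ω) (hγ : 0 < γ)
    (hXbar : ∀ t, t ≤ T → ∀ ω, X t ω ≤ Xbar t) (hΦ : Feas T p γ X Φ)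
    {t : ℕ} (ht : t ≤ T) :
    expec T p (Φ (t + 1)) ≤ expec T p (Φ t) * Real.exp (γ * Xbar t) := by
  have h : Real.exp (-γ * Xbar t) * expec T p (Φ (t + 1)) ≤ expec T p (Φ t) := by
    rw [← expec_const_mul]
    refine le_trans (expec_mono hp fun ω => ?_)
      ((expec_condExp hp t _).symm.le.trans (expec_mono hp (hΦ.2.2 t ht)))
    refine mul_le_mul_of_nonneg_right (Real.exp_le_exp.mpr ?_)
      (hΦ.pos hp hγ hXbar (Nat.succ_le_succ ht) ω).le
    nlinarith [hXbar t ht ω]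
  rwa [neg_mul, Real.exp_neg, inv_mul_le_iff₀ (Real.exp_pos _), mul_comm] at h

theorem Feas.expec_le (hp : IsProb T p) (hγ : 0 < γ)
    (hXbar : ∀ t, t ≤ T → ∀ ω, X t ω ≤ Xbar t) (hΦ : Feas T p γ X Φ)
    {τ : ℝ} (hτ : ∀ ω, Φ 0 ω ≤ τ) {t : ℕ} (ht : t ≤ T + 1) :
    expec T p (Φ t) ≤ τ * Real.exp (γ * ∑ k ∈ Finset.range t, Xbar k) := by
  induction t with
  | zero =>
    refine (expec_mono hp.1 hτ).trans ?_
    simp [expec, ← Finset.sum_mul, hp.2]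
  | succ t ih =>
    refine (hΦ.expec_succ_le hp.1 hγ hXbar (Nat.le_of_succ_le_succ ht)).trans ?_
    rw [Finset.sum_range_succ, mul_add, Real.exp_add, ← mul_assoc]
    exact mul_le_mul_of_nonneg_right (ih (Nat.le_of_succ_le ht)) (Real.exp_pos _).le

theorem Feas.abs_le (hp : IsProb T p) (hγ : 0 < γ)
    (hXbar : ∀ t, t ≤ T → ∀ ω, X t ω ≤ Xbar t) (hΦ : Feas T p γ X Φ)
    {τ : ℝ} (hτ : ∀ ω, Φ 0 ω ≤ τ) {t : ℕ} (ht : t ≤ T + 1) (ω : Traj S Ξ T) :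
    |Φ t ω| ≤ |τ * Real.exp (γ * ∑ k ∈ Finset.range t, Xbar k)| / p ω := by
  have hpos := hΦ.pos hp.1 hγ hXbar ht
  rw [abs_of_pos (hpos ω), le_div_iff₀ (hp.1 ω), mul_comm]
  calc p ω * Φ t ω ≤ expec T p (Φ t) :=
        Finset.single_le_sum (f := fun ω => p ω * Φ t ω)
          (fun ω' _ => (mul_pos (hp.1 ω') (hpos ω')).le) (Finset.mem_univ ω)
    _ ≤ τ * Real.exp (γ * ∑ k ∈ Finset.range t, Xbar k) := hΦ.expec_le hp hγ hXbar hτ ht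
    _ ≤ _ := le_abs_self _

end Feasible

/-- lower and upper bounds for feasible premium schedules of the
entropic risk frontier, and boundedness of the sublevel sets. -/
theorem stmt17 {S Ξ : Type*} [Fintype S] [Fintype Ξ] (T : ℕ)
    (p : Traj S Ξ T → ℝ) (hp : IsProb T p) (γ : ℝ) (hγ : 0 < γ)
    (X : ℕ → Traj S Ξ T → ℝ) (hX : IsPayoff T X)
    (hX0 : ∀ t, t ≤ T → ∀ ω, 0 ≤ X t ω)
    (Xbar : ℕ → ℝ) (hXbar : ∀ t, t ≤ T → ∀ ω, X t ω ≤ Xbar t) :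
    -- (a) uniform positive lower bound
    (∀ Φ, Feas T p γ X Φ → ∀ t, t ≤ T → ∀ ω,
      Real.exp (-γ * ∑ k ∈ Finset.Icc t T, Xbar k) ≤ Φ t ω) ∧
    -- (b) bound on expectations under the sublevel constraint φ₀ ≤ τ
    (∀ Φ, Feas T p γ X Φ → ∀ τ : ℝ, (∀ ω, Φ 0 ω ≤ τ) →
      ∀ t, t + 1 ≤ T →
        expec T p (Φ (t + 1)) ≤ τ * Real.exp (γ * ∑ k ∈ Finset.range (t + 1), Xbar k)) ∧
    -- consequently, every sublevel set is bounded
    ∀ τ : ℝ, ∃ C : ℝ, ∀ Φ, Feas T p γ X Φ → (∀ ω, Φ 0 ω ≤ τ) →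
      ∀ t, t ≤ T + 1 → ∀ ω, |Φ t ω| ≤ C := by
  refine ⟨fun Φ hΦ t ht => hΦ.exp_le hp.1 hγ hXbar (Nat.le_succ_of_le ht),
    fun Φ hΦ τ hτ t ht => hΦ.expec_le hp hγ hXbar hτ (Nat.le_succ_of_le ht), fun τ => ?_⟩
  have hnn : ∀ t ω, 0 ≤ |τ * Real.exp (γ * ∑ k ∈ Finset.range t, Xbar k)| / p ω :=
    fun t ω => div_nonneg (abs_nonneg _) (hp.1 ω).le
  refine ⟨∑ t ∈ Finset.range (T + 2), ∑ ω,
    |τ * Real.exp (γ * ∑ k ∈ Finset.range t, Xbar k)| / p ω, fun Φ hΦ hτ t ht ω => ?_⟩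
  calc |Φ t ω| ≤ |τ * Real.exp (γ * ∑ k ∈ Finset.range t, Xbar k)| / p ω :=
        hΦ.abs_le hp hγ hXbar hτ ht ω
    _ ≤ ∑ ω, |τ * Real.exp (γ * ∑ k ∈ Finset.range t, Xbar k)| / p ω :=
        Finset.single_le_sum (fun ω _ => hnn t ω) (Finset.mem_univ ω)
    _ ≤ _ := Finset.single_le_sum
        (f := fun t => ∑ ω, |τ * Real.exp (γ * ∑ k ∈ Finset.range t, Xbar k)| / p ω)
        (fun t _ => Finset.sum_nonneg fun ω _ => hnn t ω)
        (Finset.mem_range.mpr (Nat.lt_succ_of_le ht))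

end Stmt17
end

section
/- For each t ∈ [T], let A_t be an acceptance set of real-valued functions on Ξ that is monotone (Y ∈ A_t and Y′ ≥ Y imply Y′ ∈ A_t) and closed, and suppose the simple capital requirement ρ_{A_t}(Y) := inf{z ∈ ℝ : Y + z ∈ A_t} is finite for every bounded Y. Fix a payoff stream X_{0:T} with X_t ≤ X̄_t pointwise for constants X̄_t ∈ ℝ. Define recursively φ̲_{T+1} = 0 and φ̲_t = ρ_{A_t}(X̄_t − φ̲_{t+1}) for t = T, T−1, …, 0 (applied to the constant function X̄_t − φ̲_{t+1} on Ξ). Then every triple (X_{0:T}, Z_{0:T}, Φ_{0:T}) in the nested-risk-measure risk frontier — that is, Φ_{T+1} ≡ 0, Φ_t(h_t) ≥ Z_t(h_t), and [X_t − Φ_{t+1} | h_t] + Z_t(h_t) ∈ A_t for all h_t ∈ ℍ_t and t ∈ [T] — satisfies Z_t(h_t) ≥ φ̲_t and Φ_t(h_t) ≥ φ̲_t for all h_t ∈ ℍ_t and t ∈ [T]. -/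
open scoped Classical

namespace Stmt19

/-- The simple capital requirement `ρ_A(Y) = inf{z ∈ ℝ : Y + z ∈ A}`. -/
noncomputable def sCR {Ξ : Type*} (A : Set (Ξ → ℝ)) (Y : Ξ → ℝ) : ℝ :=
  sInf {z : ℝ | (fun ξ => Y ξ + z) ∈ A}

/-- Membership in the nested-risk-measure risk frontier built from the
acceptance sets `A_t`: `Φ_{T+1} ≡ 0`, `Φ_t(h_t) ≥ Z_t(h_t)`, and
`[X_t − Φ_{t+1} | h_t] + Z_t(h_t) ∈ A_t` for all `h_t` and `t ∈ [T]`. -/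
def NestedFrontier {S Ξ : Type*} (T : ℕ) (A : ℕ → Set (Ξ → ℝ))
    (X Z Φ : ℕ → Traj S Ξ T → ℝ) : Prop :=
  AdaptedTill T T Z ∧ AdaptedTill T (T + 1) Φ ∧
    (∀ ω, Φ (T + 1) ω = 0) ∧
    (∀ t, t ≤ T → ∀ ω, Z t ω ≤ Φ t ω) ∧
    ∀ t, t ≤ T → ∀ ω : Traj S Ξ T,
      (fun ξ => condRV T t (X t) ω ξ - condRV T t (Φ (t + 1)) ω ξ + Z t ω) ∈ A t

/-- the recursively defined constants `φ̲_t` uniformly bound from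
below the disbursements and premiums of every triple in the
nested-risk-measure risk frontier. -/
theorem stmt19 {S Ξ : Type*} (T : ℕ) (A : ℕ → Set (Ξ → ℝ))
    -- each acceptance set is monotone
    (hmono : ∀ t, t ≤ T → ∀ Y Y' : Ξ → ℝ, Y ∈ A t → (∀ ξ, Y ξ ≤ Y' ξ) → Y' ∈ A t)
    -- each acceptance set is closed
    (hclosed : ∀ t, t ≤ T → IsClosed (A t))
    -- the simple capital requirement is finite for every (bounded) payoff
    (hfin : ∀ t, t ≤ T → ∀ Y : Ξ → ℝ,
      {z : ℝ | (fun ξ => Y ξ + z) ∈ A t}.Nonempty ∧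
        BddBelow {z : ℝ | (fun ξ => Y ξ + z) ∈ A t})
    -- the payoff stream and its upper bounds
    (X : ℕ → Traj S Ξ T → ℝ) (hX : IsPayoff T X)
    (Xbar : ℕ → ℝ) (hXbar : ∀ t, t ≤ T → ∀ ω, X t ω ≤ Xbar t)
    -- the recursively defined lower bounds φ̲
    (φlow : ℕ → ℝ) (hφT1 : φlow (T + 1) = 0)
    (hφrec : ∀ t, t ≤ T → φlow t = sCR (A t) (fun _ : Ξ => Xbar t - φlow (t + 1)))
    -- any triple in the nested-risk-measure risk frontier
    (Z Φ : ℕ → Traj S Ξ T → ℝ) (hmem : NestedFrontier T A X Z Φ) :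
    ∀ t, t ≤ T → ∀ ω : Traj S Ξ T, φlow t ≤ Z t ω ∧ φlow t ≤ Φ t ω := by
  obtain ⟨-, -, hΦT1, hZΦ, hacc⟩ := hmem
  have hZ : ∀ t, t ≤ T → (∀ ω, φlow (t + 1) ≤ Φ (t + 1) ω) → ∀ ω, φlow t ≤ Z t ω := by
    intro t ht hnext ω
    rw [hφrec t ht]
    refine csInf_le (hfin t ht _).2 (hmono t ht _ _ (hacc t ht ω) fun ξ => ?_)
    have hXle := hXbar t ht (ω.1, Function.update ω.2 (finOf T t) ξ)
    have hΦle := hnext (ω.1, Function.update ω.2 (finOf T t) ξ)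
    simp only [condRV]
    linarith
  have hΦ : ∀ t, t ≤ T + 1 → ∀ ω, φlow t ≤ Φ t ω := by
    intro t ht
    induction ht using Nat.decreasingInduction with
    | self => intro ω; rw [hφT1, hΦT1]
    | of_succ t ht ih =>
      have htT : t ≤ T := Nat.lt_succ_iff.mp ht
      exact fun ω => (hZ t htT ih ω).trans (hZΦ t htT ω)
  exact fun t ht ω => ⟨hZ t ht (hΦ (t + 1) (Nat.succ_le_succ ht)) ω, hΦ t (ht.trans T.le_succ) ω⟩

end Stmt19
end
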